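/- arXiv:2109.07853 — 11 statements merged into one kernel-verified Lean document; each statement's English description precedes it below -/
import Mathlib

section
/- Let A, B ∈ ℂ[t] with A ≠ 0 and deg(A) = n, and let p ∈ ℂ[t] be a nonzero invariant polynomial, i.e., p(t)p'(t) − p(t)B(t) + A(t) = 0. Then either B = 0 or deg(B) ≤ max(deg(p) − 1, n − deg(p)). -/
open Polynomial

/-- if `p ≠ 0` is an invariant polynomial of the Abel equation,
i.e. `p p' - p B + A = 0`, with `A ≠ 0` and `deg A = n`, then either `B = 0` or
`deg B ≤ max (deg p - 1) (n - deg p)`. -/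
theorem abel_degB_le (A B p : ℂ[X]) (hA : A ≠ 0) (n : ℕ) (hn : A.natDegree = n)
    (hp : p ≠ 0) (hinv : p * derivative p - p * B + A = 0) :
    B = 0 ∨ B.natDegree ≤ max (p.natDegree - 1) (n - p.natDegree) := by
  right
  have hfac : A = p * (B - derivative p) := by linear_combination hinv
  have hq : B - derivative p ≠ 0 := fun h => hA (by rw [hfac, h, mul_zero])
  have hdeg : n = p.natDegree + (B - derivative p).natDegree := by
    rw [← hn, ← natDegree_mul hp hq, ← hfac]
  calc B.natDegree = (derivative p + (B - derivative p)).natDegree := by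
        rw [add_sub_cancel]
    _ ≤ max (derivative p).natDegree (B - derivative p).natDegree := natDegree_add_le _ _
    _ ≤ max (p.natDegree - 1) (n - p.natDegree) :=
        max_le_max (natDegree_derivative_le p) (by omega)
end

section
/- Let A, B ∈ ℂ[t] with A ≠ 0, deg(A) = n, leading coefficient a_n of A, and let p ∈ ℂ[t] be a nonconstant invariant polynomial with deg(p) = m and leading coefficient p_m, i.e., p(t)p'(t) − p(t)B(t) + A(t) = 0. Then: (a) 2·deg(p) = n + 1 if and only if (B = 0 or 2·deg(B) ≤ n − 1); (b) if 2·deg(p) = n + 1, then deg(A/p) = (n − 1)/2, and moreover (B = 0 or 2·deg(B) < n − 1) holds if and only if m·p_m² + a_n = 0, while 2·deg(B) = n − 1 holds if and only if m·p_m² + a_n ≠ 0. -/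
open Polynomial

/-- degree relations for an invariant polynomial `p` (nonconstant) of the Abel
equation `x' = A x³ + B x²`, where `n = deg A`, `m = deg p`, `p_m` is the leading coefficient
of `p` and `a_n` that of `A`:
(a) `2 deg p = n + 1 ↔ (B = 0 ∨ 2 deg B ≤ n - 1)`;
(b) if `2 deg p = n + 1` then `deg (A/p) = (n-1)/2`, and
`(B = 0 ∨ 2 deg B < n - 1) ↔ m p_m² + a_n = 0`, while
`2 deg B = n - 1` (which forces `B ≠ 0`) `↔ m p_m² + a_n ≠ 0`. -/
theorem abel_invariant_degree_half (A B p : ℂ[X]) (hA : A ≠ 0) (n : ℕ)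
    (hn : A.natDegree = n) (hp : p.natDegree ≠ 0)
    (hinv : p * derivative p - p * B + A = 0) :
    (2 * p.natDegree = n + 1 ↔ (B = 0 ∨ 2 * B.natDegree ≤ n - 1)) ∧
    (2 * p.natDegree = n + 1 →
      ((A / p).natDegree = (n - 1) / 2 ∧
        ((B = 0 ∨ 2 * B.natDegree < n - 1) ↔
          (p.natDegree : ℂ) * p.leadingCoeff ^ 2 + A.leadingCoeff = 0) ∧
        ((B ≠ 0 ∧ 2 * B.natDegree = n - 1) ↔
          (p.natDegree : ℂ) * p.leadingCoeff ^ 2 + A.leadingCoeff ≠ 0))) := by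
  obtain ⟨k, hk⟩ := Nat.exists_eq_succ_of_ne_zero hp
  have hp0 : p ≠ 0 := by rintro rfl; simp at hp
  obtain ⟨q, hq⟩ : ∃ q, q = B - derivative p := ⟨_, rfl⟩
  have hApq : A = p * q := by rw [hq]; linear_combination hinv
  have hq0 : q ≠ 0 := by rintro rfl; simp [hApq] at hA
  have hdeg : n = k + 1 + q.natDegree := by
    rw [← hn, hApq, natDegree_mul hp0 hq0, hk]
  have hBq : B = q + derivative p := by rw [hq]; ring
  have hp' : (derivative p).natDegree = k := by
    rw [natDegree_derivative, hk]; rfl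
  have hdiv : A / p = q := by rw [hApq, mul_div_cancel_left₀ _ hp0]
  have hbound : q.natDegree = k → B.natDegree ≤ k := fun h => by
    rw [hBq]
    exact (natDegree_add_le _ _).trans (by simp [h, hp'])
  constructor
  · constructor
    · intro h
      have := hbound (by omega)
      right; omega
    · rintro (h | h)
      · have : q = -derivative p := by rw [hq, h]; ring
        have : q.natDegree = k := by rw [this, natDegree_neg, hp']
        omega
      · rcases lt_trichotomy q.natDegree k with hlt | heq | hgt
        · have : B.natDegree = k := by
            rw [hBq, natDegree_add_eq_right_of_natDegree_lt (by omega), hp']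
          omega
        · omega
        · have : B.natDegree = q.natDegree := by
            rw [hBq, natDegree_add_eq_left_of_natDegree_lt (by omega)]
          omega
  · intro h
    have hqk : q.natDegree = k := by omega
    have hBk := hbound hqk
    have hcoeff : (p.natDegree : ℂ) * p.leadingCoeff ^ 2 + A.leadingCoeff =
        p.leadingCoeff * B.coeff k := by
      rw [hBq, coeff_add, coeff_derivative, hApq, leadingCoeff_mul, leadingCoeff,
        leadingCoeff, hqk, hk]
      push_cast
      ring
    have hzero : (p.natDegree : ℂ) * p.leadingCoeff ^ 2 + A.leadingCoeff = 0 ↔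
        B.coeff k = 0 := by
      rw [hcoeff, mul_eq_zero, leadingCoeff_eq_zero, or_iff_right hp0]
    have hsmall : (B = 0 ∨ 2 * B.natDegree < n - 1) ↔ B.coeff k = 0 := by
      constructor
      · rintro (hB | hB)
        · simp [hB]
        · exact coeff_eq_zero_of_natDegree_lt (by omega)
      · intro hB
        by_cases hB0 : B = 0
        · exact Or.inl hB0
        · right
          have : B.natDegree ≠ k := fun e => by
            rw [← e] at hB
            exact hB0 (leadingCoeff_eq_zero.mp hB)
          omega
    refine ⟨by rw [hdiv]; omega, hsmall.trans hzero.symm, ?_⟩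
    rw [ne_eq (_ + _), hzero, ← hsmall, not_or]
    exact and_congr_right fun _ => by omega
end

section
/- Let A, B ∈ ℂ[t] with A ≠ 0, and let p₁, p₂ ∈ ℂ[t] be two distinct invariant polynomials, i.e., pᵢ(t)pᵢ'(t) − pᵢ(t)B(t) + A(t) = 0 for i = 1, 2 and p₁ ≠ p₂. Then p₁ and p₂ are not relatively prime: gcd(p₁, p₂) is not a unit (equivalently, the monic gcd of p₁ and p₂ is a nonconstant polynomial). -/
open Polynomial

/-- two distinct invariant polynomials `p₁ ≠ p₂` of the Abel equation
are never relatively prime: their gcd is not a unit (equivalently, they are not coprime). -/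
theorem abel_invariants_not_coprime (A B p₁ p₂ : ℂ[X]) (hA : A ≠ 0) (h12 : p₁ ≠ p₂)
    (h1 : p₁ * derivative p₁ - p₁ * B + A = 0)
    (h2 : p₂ * derivative p₂ - p₂ * B + A = 0) :
    ¬ IsCoprime p₁ p₂ := by
  intro hcop
  obtain ⟨C, hC⟩ : p₁ * p₂ ∣ A :=
    hcop.mul_dvd ⟨B - derivative p₁, by linear_combination h1⟩
      ⟨B - derivative p₂, by linear_combination h2⟩
  have hp : p₁ * p₂ ≠ 0 := fun h => hA (by rw [hC, h, zero_mul])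
  have hd : derivative (p₁ - p₂) = (p₁ - p₂) * C := by
    apply mul_left_cancel₀ hp
    rw [derivative_sub]
    linear_combination p₂ * h1 - p₁ * h2 + (p₁ - p₂) * hC
  have hzero : derivative (p₁ - p₂) = 0 := dvd_derivative_iff.mp ⟨C, hd⟩
  have hC0 : C = 0 :=
    (mul_eq_zero.mp (hd.symm.trans hzero)).resolve_left (sub_ne_zero.mpr h12)
  exact hA (by rw [hC, hC0, mul_zero])
end

section
/- Let A, B ∈ ℂ[t] with A ≠ 0, and let p₁ ≠ p₂ be two invariant polynomials, i.e., pᵢpᵢ' − pᵢB + A = 0 for i = 1, 2. Let q be the monic greatest common divisor of p₁ and p₂, write p₁ = q·s₁ and p₂ = q·s₂ (so gcd(s₁, s₂) = 1), and let s ∈ ℂ[t] be the polynomial with A = q·s₁·s₂·s (it exists since the least common multiple q·s₁·s₂ of p₁ and p₂ divides A). Let q = ∏_{i=1}^l qᵢ^{δᵢ} be the decomposition of q into powers of pairwise distinct monic irreducible polynomials qᵢ with multiplicities δᵢ ≥ 1. Then there exist C ∈ ℂ \ {0} and non-negative integers γ₁, …, γ_l such that s₁ = s₂ + C·∏_{i=1}^l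 qᵢ^{γᵢ} and s = gcd(q, q')·∑_{i=1}^l (δᵢ + γᵢ)·qᵢ'·∏_{j ≠ i} qⱼ, where gcd(q, q') is the monic gcd and, when l = 1, the empty product ∏_{j ≠ i} qⱼ equals 1. -/
open Polynomial

section ProductOfPowers

variable {ι K : Type*} [Fintype ι] [Field K]

theorem derivative_prod_pow_eq_mul_sum [DecidableEq ι] (f : ι → K[X]) (n : ι → ℕ)
    (hn : ∀ i, 1 ≤ n i) :
    derivative (∏ i, f i ^ n i) = (∏ i, f i ^ (n i - 1)) *
      ∑ i, Polynomial.C ((n i : ℕ) : K) *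
        (derivative (f i) * ∏ j ∈ Finset.univ.erase i, f j) := by
  rw [derivative_prod_finset, Finset.mul_sum]
  refine Finset.sum_congr rfl fun i _ => ?_
  have hsplit : ∏ j ∈ Finset.univ.erase i, f j ^ n j =
      (∏ j ∈ Finset.univ.erase i, f j ^ (n j - 1)) * ∏ j ∈ Finset.univ.erase i, f j := by
    rw [← Finset.prod_mul_distrib]
    exact Finset.prod_congr rfl fun j _ => by rw [pow_sub_one_mul (by have := hn j; omega)]
  rw [hsplit, ← Finset.mul_prod_erase Finset.univ (fun j => f j ^ (n j - 1)) (Finset.mem_univ i),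
    derivative_pow]
  ring

theorem isCoprime_prod_sum_derivative [DecidableEq ι] [CharZero K]
    (f : ι → K[X]) (n : ι → ℕ)
    (hmonic : ∀ i, (f i).Monic) (hirr : ∀ i, Irreducible (f i)) (hf : Function.Injective f)
    (hn : ∀ i, 1 ≤ n i) :
    IsCoprime (∏ i, f i) (∑ i, Polynomial.C ((n i : ℕ) : K) *
      (derivative (f i) * ∏ j ∈ Finset.univ.erase i, f j)) := by
  refine IsCoprime.prod_left fun i _ => ?_
  rw [← Finset.add_sum_erase _ _ (Finset.mem_univ i)]
  have hrest : f i ∣ ∑ k ∈ Finset.univ.erase i, Polynomial.C ((n k : ℕ) : K) *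
      (derivative (f k) * ∏ j ∈ Finset.univ.erase k, f j) := by
    refine Finset.dvd_sum fun k hk => Dvd.dvd.mul_left (Dvd.dvd.mul_left ?_ _) _
    exact Finset.dvd_prod_of_mem _
      (Finset.mem_erase.2 ⟨(Finset.ne_of_mem_erase hk).symm, Finset.mem_univ i⟩)
  obtain ⟨r, hr⟩ := hrest
  rw [hr, mul_comm (f i) r, IsCoprime.add_mul_right_right_iff]
  refine IsCoprime.mul_right ?_ (IsCoprime.mul_right (hirr i).separable
    (IsCoprime.prod_right fun j hj => ?_))
  · have hu : IsUnit (Polynomial.C ((n i : ℕ) : K)) :=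
      isUnit_C.2 (Nat.cast_ne_zero.2 (by have := hn i; omega)).isUnit
    simpa using (isCoprime_mul_unit_left_right hu (f i) 1).2 isCoprime_one_right
  · refine (hirr i).coprime_iff_not_dvd.2 fun h => Finset.ne_of_mem_erase hj (hf ?_)
    exact (eq_of_monic_of_associated (hmonic i) (hmonic j)
      ((hirr i).associated_of_dvd (hirr j) h)).symm

theorem exists_eq_C_mul_prod_pow_of_roots [IsAlgClosed K] (f : ι → K[X])
    (hmonic : ∀ i, (f i).Monic) (hirr : ∀ i, Irreducible (f i)) (hf : Function.Injective f)
    {p : K[X]} (hp : p ≠ 0) (hroots : ∀ x, p.IsRoot x → (∏ i, f i).IsRoot x) :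
    ∃ (c : K) (n : ι → ℕ), c ≠ 0 ∧ p = Polynomial.C c * ∏ i, f i ^ n i := by
  classical
  have hlin : ∀ i, ∃ a : K, f i = X - Polynomial.C a := fun i => ⟨-(f i).coeff 0, by
    rw [C_neg, sub_neg_eq_add]
    exact (hmonic i).eq_X_add_C
      (natDegree_eq_of_degree_eq_some (IsAlgClosed.degree_eq_one_of_irreducible K (hirr i)))⟩
  choose a ha using hlin
  have hinj : Function.Injective a := fun i j h => hf (by rw [ha, ha, h])
  refine ⟨p.leadingCoeff, fun i => rootMultiplicity (a i) p, leadingCoeff_ne_zero.2 hp, ?_⟩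
  have hsub : p.roots.toFinset ⊆ Finset.univ.image a := fun x hx => by
    have h := hroots x (isRoot_of_mem_roots (Multiset.mem_toFinset.1 hx))
    simp only [IsRoot.def, eval_prod, Finset.prod_eq_zero_iff, ha, eval_sub, eval_X, eval_C,
      sub_eq_zero] at h
    obtain ⟨i, hi, h⟩ := h
    exact Finset.mem_image.2 ⟨i, hi, h.symm⟩
  conv_lhs => rw [(IsAlgClosed.splits p).eq_prod_roots, prod_multiset_root_eq_finset_root]
  rw [Finset.prod_subset hsub, Finset.prod_image hinj.injOn]
  · simp only [ha]
  · intro x _ hx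
    rw [Multiset.mem_toFinset, ← count_roots, ← Multiset.count_eq_zero] at *
    simp_all

end ProductOfPowers

theorem gcd_prod_pow_derivative {ι : Type*} [Fintype ι] [DecidableEq ι] (f : ι → ℂ[X])
    (n : ι → ℕ) (hmonic : ∀ i, (f i).Monic) (hirr : ∀ i, Irreducible (f i))
    (hf : Function.Injective f) (hn : ∀ i, 1 ≤ n i) :
    gcd (∏ i, f i ^ n i) (derivative (∏ i, f i ^ n i)) = ∏ i, f i ^ (n i - 1) := by
  have hsplit : ∏ i, f i ^ n i = (∏ i, f i ^ (n i - 1)) * ∏ i, f i := by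
    rw [← Finset.prod_mul_distrib]
    exact Finset.prod_congr rfl fun i _ => by rw [pow_sub_one_mul (by have := hn i; omega)]
  have hgcd := normalize_eq_one.2 ((gcd_isUnit_iff _ _).2
    (isCoprime_prod_sum_derivative f n hmonic hirr hf hn))
  rw [normalize_gcd] at hgcd
  rw [derivative_prod_pow_eq_mul_sum f n hn, hsplit, gcd_mul_left,
    hgcd, mul_one]
  exact (monic_prod_of_monic _ _ fun i _ => (hmonic i).pow _).normalize_eq_self

/-- structure of two distinct invariant polynomials `p₁ = q s₁`, `p₂ = q s₂`
(`q` the monic gcd) of the Abel equation, with `A = q s₁ s₂ s` and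
`q = ∏ qᵢ^δᵢ` the decomposition of `q` into distinct monic irreducible factors:
there are `C ≠ 0` and non-negative integers `γᵢ` with
`s₁ = s₂ + C ∏ qᵢ^γᵢ` and `s = gcd(q,q') ∑ (δᵢ+γᵢ) qᵢ' ∏_{j≠i} qⱼ`. -/
theorem abel_two_invariants_structure (A B p₁ p₂ q s₁ s₂ s : ℂ[X]) (hA : A ≠ 0)
    (h12 : p₁ ≠ p₂)
    (h1 : p₁ * derivative p₁ - p₁ * B + A = 0)
    (h2 : p₂ * derivative p₂ - p₂ * B + A = 0)
    (hq : q = gcd p₁ p₂)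
    (hs1 : p₁ = q * s₁) (hs2 : p₂ = q * s₂)
    (hAs : A = q * s₁ * s₂ * s)
    (l : ℕ) (qi : Fin l → ℂ[X]) (δ : Fin l → ℕ)
    (hmonic : ∀ i, (qi i).Monic) (hirr : ∀ i, Irreducible (qi i))
    (hne : ∀ i j, i ≠ j → qi i ≠ qi j) (hδ : ∀ i, 1 ≤ δ i)
    (hdecomp : q = ∏ i, qi i ^ δ i) :
    ∃ (C : ℂ) (γ : Fin l → ℕ), C ≠ 0 ∧
      s₁ = s₂ + Polynomial.C C * ∏ i, qi i ^ γ i ∧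
      s = gcd q (derivative q) *
        ∑ i, Polynomial.C ((δ i + γ i : ℕ) : ℂ) *
          (derivative (qi i) * ∏ j ∈ Finset.univ.erase i, qi j) := by
  have hq0 : q ≠ 0 := by rintro rfl; exact hA (by simp [hAs])
  have hs₁ : s₁ ≠ 0 := by rintro rfl; exact hA (by simp [hAs])
  have hs₂ : s₂ ≠ 0 := by rintro rfl; exact hA (by simp [hAs])
  have hinj : Function.Injective qi := fun i j h => by_contra fun hij => hne i j hij h
  have hD : s₁ - s₂ ≠ 0 := fun h => h12 (by rw [hs1, hs2, sub_eq_zero.1 h])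
  have e1 : derivative p₁ - B + s₂ * s = 0 := by
    refine (mul_eq_zero.1 ?_).resolve_left (mul_ne_zero hq0 hs₁)
    rw [← hs1]
    linear_combination h1 - hAs + s₂ * s * hs1
  have e2 : derivative p₂ - B + s₁ * s = 0 := by
    refine (mul_eq_zero.1 ?_).resolve_left (mul_ne_zero hq0 hs₂)
    rw [← hs2]
    linear_combination h2 - hAs + s₁ * s * hs2
  have hderiv : derivative (q * (s₁ - s₂)) = (s₁ - s₂) * s := by
    rw [mul_sub, ← hs1, ← hs2, derivative_sub]
    linear_combination e1 - e2
  have hdvd : s₁ - s₂ ∣ derivative (s₁ - s₂) * q :=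
    ⟨s - derivative q, by rw [derivative_mul] at hderiv; linear_combination hderiv⟩
  obtain ⟨c, γ, hc, hprod⟩ := exists_eq_C_mul_prod_pow_of_roots qi hmonic hirr hinj hD
    fun x hx => by
      have h := isRoot_of_isRoot_of_dvd_derivative_mul hD hdvd hx
      rw [hdecomp, IsRoot.def, eval_prod, Finset.prod_eq_zero_iff] at h
      obtain ⟨i, hi, h⟩ := h
      rw [IsRoot.def, eval_prod]
      exact Finset.prod_eq_zero hi (eq_zero_of_pow_eq_zero (by simpa using h))
  refine ⟨c, γ, hc, by rw [← hprod]; ring, mul_left_cancel₀ hD ?_⟩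
  have hqD : q * (s₁ - s₂) = Polynomial.C c * ∏ i, qi i ^ (δ i + γ i) := by
    simp only [hprod, hdecomp, pow_add, Finset.prod_mul_distrib]
    ring
  have hpow : ∏ i, qi i ^ (δ i + γ i - 1) = (∏ i, qi i ^ (δ i - 1)) * ∏ i, qi i ^ γ i := by
    rw [← Finset.prod_mul_distrib]
    refine Finset.prod_congr rfl fun i _ => ?_
    rw [← pow_add, Nat.sub_add_comm (hδ i)]
  rw [← hderiv, hqD, derivative_C_mul,
    derivative_prod_pow_eq_mul_sum qi (fun i => δ i + γ i) fun i => le_add_right (hδ i), hpow,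
    hdecomp, gcd_prod_pow_derivative qi δ hmonic hirr hinj hδ, hprod]
  ring
end

section
/- Let A, B ∈ ℂ[t] with A ≠ 0 and deg(A) = n, and let p₁ ≠ p₂ be two invariant polynomials, i.e., pᵢpᵢ' − pᵢB + A = 0 for i = 1, 2. Let q be the monic gcd of p₁ and p₂ and let s ∈ ℂ[t] be the polynomial with A·q = p₁·p₂·s. Then: (i) deg(s) = deg(q) − 1; (ii) deg(p₁) + deg(p₂) = n + 1; (iii) deg(p₁) = deg(p₂) if and only if 2·deg(p₁) = n + 1. -/
open Polynomial

/-- degrees for two distinct invariant polynomials `p₁ ≠ p₂` of the Abel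
equation, `q` their monic gcd and `s` defined by `A q = p₁ p₂ s`:
(i) `deg s = deg q - 1`; (ii) `deg p₁ + deg p₂ = n + 1`;
(iii) `deg p₁ = deg p₂ ↔ 2 deg p₁ = n + 1`. -/
theorem abel_two_invariants_degrees (A B p₁ p₂ s : ℂ[X]) (hA : A ≠ 0) (n : ℕ)
    (hn : A.natDegree = n) (h12 : p₁ ≠ p₂)
    (h1 : p₁ * derivative p₁ - p₁ * B + A = 0)
    (h2 : p₂ * derivative p₂ - p₂ * B + A = 0)
    (hs : A * gcd p₁ p₂ = p₁ * p₂ * s) :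
    s.natDegree = (gcd p₁ p₂).natDegree - 1 ∧
    p₁.natDegree + p₂.natDegree = n + 1 ∧
    (p₁.natDegree = p₂.natDegree ↔ 2 * p₁.natDegree = n + 1) := by
  have hp : p₁ * p₂ ≠ 0 := by
    refine mul_ne_zero (fun h => hA ?_) (fun h => hA ?_)
    · simpa [h] using h1
    · simpa [h] using h2
  have hp₁ := left_ne_zero_of_mul hp
  have hp₂ := right_ne_zero_of_mul hp
  have hq : gcd p₁ p₂ ≠ 0 := fun h => hp₁ ((gcd_eq_zero_iff _ _).1 h).1
  have hs0 : s ≠ 0 := by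
    rintro rfl
    exact mul_ne_zero hA hq (by simpa using hs)
  have hw : p₁ - p₂ ≠ 0 := sub_ne_zero.2 h12
  have key : gcd p₁ p₂ * derivative (p₁ - p₂) = s * (p₁ - p₂) := by
    apply mul_left_cancel₀ hp
    rw [derivative_sub]
    linear_combination gcd p₁ p₂ * (p₂ * h1 - p₁ * h2) + (p₁ - p₂) * hs
  have hw' : derivative (p₁ - p₂) ≠ 0 :=
    right_ne_zero_of_mul (key ▸ mul_ne_zero hs0 hw)
  have hwdeg : (p₁ - p₂).natDegree ≠ 0 := fun h =>
    hw' (derivative_of_natDegree_zero h)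
  have hdeg := congrArg natDegree key
  rw [natDegree_mul hq hw', natDegree_mul hs0 hw, natDegree_derivative] at hdeg
  have hsdeg := congrArg natDegree hs
  rw [natDegree_mul hA hq, natDegree_mul hp hs0, natDegree_mul hp₁ hp₂, hn] at hsdeg
  omega
end

section
/- Let A, B ∈ ℂ[t] with A ≠ 0 and deg(A) = n. If p₁, p₂, p₃ ∈ ℂ[t] are three pairwise distinct invariant polynomials (pᵢpᵢ' − pᵢB + A = 0 for i = 1, 2, 3), then 2·deg(pᵢ) = n + 1 for each i = 1, 2, 3 (in particular n is odd). -/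
open Polynomial

/-- The degrees of two distinct invariant polynomials add up to `deg A + 1`. -/
theorem natDegree_add_natDegree_of_invariant {K : Type*} [Field K] [CharZero K] {A B p q : K[X]}
    (hA : A ≠ 0) (hpq : p ≠ q)
    (hp : p * derivative p - p * B + A = 0) (hq : q * derivative q - q * B + A = 0) :
    p.natDegree + q.natDegree = A.natDegree + 1 := by
  have key : p * q * derivative (p - q) = A * (p - q) := by
    rw [derivative_sub]
    linear_combination q * hp - p * hq
  have hd : p - q ≠ 0 := sub_ne_zero.mpr hpq
  have hprod : p * q * derivative (p - q) ≠ 0 := key ▸ mul_ne_zero hA hd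
  have hpq0 : p * q ≠ 0 := left_ne_zero_of_mul hprod
  have hd' : derivative (p - q) ≠ 0 := right_ne_zero_of_mul hprod
  have hpos : (p - q).natDegree ≠ 0 := fun h => hd' (derivative_of_natDegree_zero h)
  have hdeg := congrArg natDegree key
  rw [natDegree_mul hpq0 hd', natDegree_mul (left_ne_zero_of_mul hpq0)
    (right_ne_zero_of_mul hpq0), natDegree_mul hA hd, natDegree_derivative] at hdeg
  omega

/-- if the Abel equation has three pairwise distinct invariant polynomials,
then each of them has degree `(n+1)/2`, i.e. `2 deg pᵢ = n + 1` (in particular `n` is odd). -/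
theorem abel_three_invariants_degree (A B p₁ p₂ p₃ : ℂ[X]) (hA : A ≠ 0) (n : ℕ)
    (hn : A.natDegree = n)
    (h12 : p₁ ≠ p₂) (h13 : p₁ ≠ p₃) (h23 : p₂ ≠ p₃)
    (h1 : p₁ * derivative p₁ - p₁ * B + A = 0)
    (h2 : p₂ * derivative p₂ - p₂ * B + A = 0)
    (h3 : p₃ * derivative p₃ - p₃ * B + A = 0) :
    2 * p₁.natDegree = n + 1 ∧ 2 * p₂.natDegree = n + 1 ∧ 2 * p₃.natDegree = n + 1 ∧
    Odd n := by
  have e12 := natDegree_add_natDegree_of_invariant hA h12 h1 h2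
  have e13 := natDegree_add_natDegree_of_invariant hA h13 h1 h3
  have e23 := natDegree_add_natDegree_of_invariant hA h23 h2 h3
  rw [Nat.odd_iff]
  omega
end

section
/- Let A, B ∈ ℂ[t], let p ∈ ℂ[t] with p ≠ 0, and let K ∈ ℂ with K ≠ 0 and K ≠ 1. Then p and K·p are both invariant polynomials of the Abel equation x' = A(t)x³ + B(t)x² (i.e., both satisfy the equation r·r' − r·B + A = 0) if and only if A = K·p'·p and B = (K + 1)·p'. -/
open Polynomial

/-- for `p ≠ 0` and `K ∈ ℂ`, `K ≠ 0, 1`, the polynomials `p` and `K p` are both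
invariant for the Abel equation `x' = A x³ + B x²` iff `A = K p' p` and `B = (K+1) p'`. -/
theorem abel_proportional_invariants_iff (A B p : ℂ[X]) (hp : p ≠ 0)
    (K : ℂ) (hK0 : K ≠ 0) (hK1 : K ≠ 1) :
    ((p * derivative p - p * B + A = 0) ∧
      ((Polynomial.C K * p) * derivative (Polynomial.C K * p) -
        (Polynomial.C K * p) * B + A = 0)) ↔
    (A = Polynomial.C K * derivative p * p ∧ B = Polynomial.C (K + 1) * derivative p) := by
  have hC : (C K - 1 : ℂ[X]) ≠ 0 := by
    rw [← C_1, ← C_sub]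
    exact C_ne_zero.mpr (sub_ne_zero.mpr hK1)
  rw [derivative_C_mul, C_add, C_1]
  constructor
  · rintro ⟨h₁, h₂⟩
    have hB : B = (C K + 1) * derivative p := by
      apply mul_left_cancel₀ (mul_ne_zero hC hp)
      linear_combination h₁ - h₂
    refine ⟨?_, hB⟩
    rw [hB] at h₁
    linear_combination h₁
  · rintro ⟨rfl, rfl⟩
    constructor <;> ring
end

section
/- Let A, B ∈ ℂ[t] with A ≠ 0 and deg(A) = n, where n is odd. Then the set {p ∈ ℂ[t] : p ≠ 0 and p·p' − p·B + A = 0} of invariant polynomials is finite and has at most C(n, (n+1)/2) + 1 elements, where C(n, k) denotes the binomial coefficient; that is, the Abel equation x' = A(t)x³ + B(t)x² has at most C(n, (n+1)/2) + 1 invariant curves 1 + p(t)x = 0. -/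
open Polynomial

namespace AbelEquation

variable {K : Type*} [Field K] {A B p q : K[X]}

theorem eq_C_of_derivative_eq_zero [CharZero K] (h : derivative p = 0) : ∃ c, p = C c :=
  ⟨p.coeff 0, eq_C_of_natDegree_eq_zero (Polynomial.derivative_eq_zero.1 h)⟩

/-- The degrees of two distinct invariant polynomials add up to `deg A + 1`. -/
theorem natDegree_add_natDegree_of_invariant [CharZero K] (hA : A ≠ 0)
    (hp₀ : p ≠ 0) (hp : p * derivative p - p * B + A = 0)
    (hq₀ : q ≠ 0) (hq : q * derivative q - q * B + A = 0) (hpq : p ≠ q) :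
    p.natDegree + q.natDegree = A.natDegree + 1 := by
  have hsub : p - q ≠ 0 := sub_ne_zero.2 hpq
  have key : derivative (p - q) * (p * q) = A * (p - q) := by
    rw [derivative_sub]
    linear_combination q * hp - p * hq
  have hder : derivative (p - q) ≠ 0 := by
    intro h
    rw [h, zero_mul] at key
    exact mul_ne_zero hA hsub key.symm
  have hpos : 0 < (p - q).natDegree := by
    refine Nat.pos_of_ne_zero fun h => hder ?_
    rw [eq_C_of_natDegree_eq_zero h, derivative_C]
  have hdeg : (derivative (p - q)).natDegree = (p - q).natDegree - 1 :=
    natDegree_eq_of_degree_eq_some (degree_derivative hpos.ne')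
  have := congrArg natDegree key
  rw [natDegree_mul hder (mul_ne_zero hp₀ hq₀), natDegree_mul hp₀ hq₀, natDegree_mul hA hsub,
    hdeg] at this
  omega

/-- If `p` and `c p` are distinct invariant polynomials, then `A = c p p'` and `B = (1 + c) p'`. -/
theorem eq_of_invariant_of_C_mul_invariant {c : K} (hc : c ≠ 1) (hp₀ : p ≠ 0)
    (hp : p * derivative p - p * B + A = 0)
    (hcp : (C c * p) * derivative (C c * p) - (C c * p) * B + A = 0) :
    A = C c * (p * derivative p) ∧ B = C (1 + c) * derivative p := by
  have hc' : (C (1 - c) : K[X]) ≠ 0 := C_ne_zero.2 (sub_ne_zero.2 hc.symm)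
  rw [derivative_C_mul] at hcp
  have hA' : A = C c * (p * derivative p) := by
    refine mul_left_cancel₀ hc' ?_
    simp only [map_sub, map_one]
    linear_combination hcp - C c * hp
  refine ⟨hA', mul_left_cancel₀ hp₀ ?_⟩
  simp only [map_add, map_one]
  linear_combination hA' - hp

/-- At most one pair of distinct invariant polynomials is proportional. -/
theorem eq_or_eq_C_mul_of_proportional_invariants [CharZero K] {c d : K} (hA : A ≠ 0)
    (hc : c ≠ 1) (hp₀ : p ≠ 0) (hp : p * derivative p - p * B + A = 0)
    (hcp : (C c * p) * derivative (C c * p) - (C c * p) * B + A = 0)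
    (hd : d ≠ 1) (hq₀ : q ≠ 0) (hq : q * derivative q - q * B + A = 0)
    (hdq : (C d * q) * derivative (C d * q) - (C d * q) * B + A = 0) :
    q = p ∨ q = C c * p := by
  obtain ⟨hA₁, hB₁⟩ := eq_of_invariant_of_C_mul_invariant hc hp₀ hp hcp
  obtain ⟨hA₂, hB₂⟩ := eq_of_invariant_of_C_mul_invariant hd hq₀ hq hdq
  have hc₀ : c ≠ 0 := by rintro rfl; simp [hA₁] at hA
  have hd₀ : d ≠ 0 := by rintro rfl; simp [hA₂] at hA
  have hp' : derivative p ≠ 0 := by intro h; simp [hA₁, h] at hA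
  have hq' : derivative q ≠ 0 := by intro h; simp [hA₂, h] at hA
  have hprod : C c * (p * derivative p) = C d * (q * derivative q) := hA₁.symm.trans hA₂
  have hder : C (1 + c) * derivative p = C (1 + d) * derivative q := hB₁.symm.trans hB₂
  obtain ⟨k, rfl⟩ : ∃ k : K, q = C k * p := by
    by_cases hd1 : 1 + d = 0
    · have hc1 : 1 + c = 0 := by
        rw [hd1, C_0, zero_mul] at hder
        exact C_eq_zero.1 ((mul_eq_zero.1 hder).resolve_right hp')
      obtain rfl : c = d := by linear_combination hc1 - hd1
      have hpq := mul_left_cancel₀ (C_ne_zero.2 hc₀) hprod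
      obtain ⟨e, he⟩ : ∃ e, (p - q) * (p + q) = C e := by
        apply eq_C_of_derivative_eq_zero
        simp only [derivative_mul, derivative_sub, derivative_add]
        linear_combination 2 * hpq
      by_cases he₀ : e = 0
      · rw [he₀, C_0] at he
        rcases mul_eq_zero.1 he with h | h
        · exact ⟨1, by rw [C_1]; linear_combination -h⟩
        · exact ⟨-1, by rw [C_neg, C_1]; linear_combination h⟩
      · have hu : IsUnit ((p - q) * (p + q)) := he ▸ isUnit_C.2 (isUnit_iff_ne_zero.2 he₀)
        have h₁ := natDegree_eq_zero_of_isUnit (isUnit_of_mul_isUnit_left hu)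
        have h₂ := natDegree_eq_zero_of_isUnit (isUnit_of_mul_isUnit_right hu)
        have h₃ : derivative (p - q) = 0 := by rw [eq_C_of_natDegree_eq_zero h₁, derivative_C]
        have h₄ : derivative (p + q) = 0 := by rw [eq_C_of_natDegree_eq_zero h₂, derivative_C]
        rw [derivative_sub] at h₃
        rw [derivative_add] at h₄
        refine absurd (mul_left_cancel₀ (two_ne_zero (α := K[X])) ?_) hp'
        linear_combination h₃ + h₄
    · set k := (1 + c) / (1 + d) with hk
      have hqk : derivative q = C k * derivative p := by
        refine mul_left_cancel₀ (C_ne_zero.2 hd1) ?_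
        rw [← hder, ← mul_assoc, ← C_mul, hk, mul_div_cancel₀ _ hd1]
      have hk₀ : k ≠ 0 := by intro h; simp [hqk, h] at hq'
      have hpq : C c * p = C (d * k) * q := by
        refine mul_right_cancel₀ hp' ?_
        rw [C_mul]
        linear_combination hprod + C d * q * hqk
      refine ⟨c / (d * k), mul_left_cancel₀ (C_ne_zero.2 (mul_ne_zero hd₀ hk₀)) ?_⟩
      rw [← hpq, ← mul_assoc, ← C_mul, mul_div_cancel₀ _ (mul_ne_zero hd₀ hk₀)]
  rw [derivative_C_mul] at hprod hder
  have hsum : 1 + c = (1 + d) * k := by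
    apply C_injective
    refine mul_right_cancel₀ hp' ?_
    rw [hder, C_mul]; ring
  have hmul : c = d * k * k := by
    apply C_injective
    refine mul_right_cancel₀ (mul_ne_zero hp₀ hp') ?_
    rw [hprod, C_mul, C_mul]; ring
  have hk : (k - 1) * (d * k - 1) = 0 := by linear_combination hsum - hmul
  rcases mul_eq_zero.1 hk with h | h
  · left
    rw [sub_eq_zero.1 h, C_1, one_mul]
  · right
    rw [show k = c by linear_combination -hmul - k * h]

theorem exists_eq_C_mul_of_roots_eq [IsAlgClosed K] (hp₀ : p ≠ 0) (h : p.roots = q.roots) :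
    ∃ c, q = C c * p := by
  refine ⟨q.leadingCoeff / p.leadingCoeff, ?_⟩
  conv_lhs => rw [(IsAlgClosed.splits q).eq_prod_roots]
  conv_rhs => arg 2; rw [(IsAlgClosed.splits p).eq_prod_roots]
  rw [h, ← mul_assoc, ← C_mul, div_mul_cancel₀ _ (leadingCoeff_ne_zero.2 hp₀)]

/-- At most one pair of distinct invariant polynomials has the same roots. -/
theorem eq_or_eq_of_roots_eq [CharZero K] [IsAlgClosed K] {r s : K[X]} (hA : A ≠ 0)
    (hp₀ : p ≠ 0) (hp : p * derivative p - p * B + A = 0)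
    (hq : q * derivative q - q * B + A = 0) (hpq : p ≠ q) (hpq_roots : p.roots = q.roots)
    (hr₀ : r ≠ 0) (hr : r * derivative r - r * B + A = 0)
    (hs : s * derivative s - s * B + A = 0) (hrs : r ≠ s) (hrs_roots : r.roots = s.roots) :
    r = p ∨ r = q := by
  obtain ⟨c, rfl⟩ := exists_eq_C_mul_of_roots_eq hp₀ hpq_roots
  obtain ⟨d, rfl⟩ := exists_eq_C_mul_of_roots_eq hr₀ hrs_roots
  refine eq_or_eq_C_mul_of_proportional_invariants hA ?_ hp₀ hp hq ?_ hr₀ hr hs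
  · rintro rfl; simp at hpq
  · rintro rfl; simp at hrs

/-- A finite set of invariant polynomials of the same degree `m` has at most
`C(deg A, m) + 1` elements. -/
theorem card_le_of_natDegree_eq [CharZero K] [IsAlgClosed K] {F : Finset K[X]} {m : ℕ} (hA : A ≠ 0)
    (hF : ∀ p ∈ F, p ≠ 0 ∧ p * derivative p - p * B + A = 0) (hm : ∀ p ∈ F, p.natDegree = m) :
    F.card ≤ A.natDegree.choose m + 1 := by
  classical
  have key : ∀ G ⊆ F, Set.InjOn roots (G : Set K[X]) → G.card ≤ A.natDegree.choose m := by
    intro G hG hinj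
    calc G.card ≤ (Multiset.powersetCard m A.roots).toFinset.card := by
          refine Finset.card_le_card_of_injOn roots (fun p hp => ?_) hinj
          have hp := hG hp
          have hdvd : p ∣ A := ⟨B - derivative p, by linear_combination (hF p hp).2⟩
          simp only [Finset.mem_coe, Multiset.mem_toFinset, Multiset.mem_powersetCard]
          exact ⟨roots.le_of_dvd hA hdvd,
            (splits_iff_card_roots.1 (IsAlgClosed.splits p)).trans (hm p hp)⟩
      _ ≤ (Multiset.powersetCard m A.roots).card := Multiset.toFinset_card_le _
      _ = A.natDegree.choose m := by
          rw [Multiset.card_powersetCard, splits_iff_card_roots.1 (IsAlgClosed.splits A)]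
  by_cases hinj : Set.InjOn roots (F : Set K[X])
  · exact (key F subset_rfl hinj).trans (Nat.le_succ _)
  · simp only [Set.InjOn, not_forall, Finset.mem_coe] at hinj
    obtain ⟨p, hp, q, hq, hpq_roots, hpq⟩ := hinj
    have hcard := key (F.erase q) (Finset.erase_subset _ _) (by
      intro r hr s hs hrs_roots
      by_contra hrs
      obtain ⟨hrq, hr⟩ := Finset.mem_erase.1 hr
      obtain ⟨hsq, hs⟩ := Finset.mem_erase.1 hs
      have h₁ := eq_or_eq_of_roots_eq hA (hF p hp).1 (hF p hp).2 (hF q hq).2 hpq hpq_roots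
        (hF r hr).1 (hF r hr).2 (hF s hs).2 hrs hrs_roots
      have h₂ := eq_or_eq_of_roots_eq hA (hF p hp).1 (hF p hp).2 (hF q hq).2 hpq hpq_roots
        (hF s hs).1 (hF s hs).2 (hF r hr).2 (Ne.symm hrs) hrs_roots.symm
      exact hrs ((h₁.resolve_right hrq).trans (h₂.resolve_right hsq).symm))
    have := Finset.card_erase_add_one hq
    omega

theorem card_le_choose_add_one [CharZero K] [IsAlgClosed K] {F : Finset K[X]} (hA : A ≠ 0)
    (hodd : Odd A.natDegree)
    (hF : ∀ p ∈ F, p ≠ 0 ∧ p * derivative p - p * B + A = 0) :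
    F.card ≤ A.natDegree.choose ((A.natDegree + 1) / 2) + 1 := by
  classical
  have hadd : ∀ p ∈ F, ∀ q ∈ F, p ≠ q → p.natDegree + q.natDegree = A.natDegree + 1 :=
    fun p hp q hq => natDegree_add_natDegree_of_invariant hA (hF p hp).1 (hF p hp).2
      (hF q hq).1 (hF q hq).2
  rcases le_or_gt F.card 2 with h2 | h2
  · have := hodd.pos
    have : 0 < A.natDegree.choose ((A.natDegree + 1) / 2) := Nat.choose_pos (by omega)
    omega
  · refine card_le_of_natDegree_eq hA hF fun p hp => ?_
    have hone : 1 < (F.erase p).card := by rw [Finset.card_erase_of_mem hp]; omega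
    obtain ⟨q, hq, r, hr, hqr⟩ := Finset.one_lt_card.1 hone
    obtain ⟨hqp, hq⟩ := Finset.mem_erase.1 hq
    obtain ⟨hrp, hr⟩ := Finset.mem_erase.1 hr
    have := hadd q hq p hp hqp
    have := hadd r hr p hp hrp
    have := hadd q hq r hr hqr
    omega

end AbelEquation

/-- Theorem A, second part: if `n = deg A` is odd, then the set of invariant
polynomials of the Abel equation `x' = A x³ + B x²` is finite with at most
`C(n, (n+1)/2) + 1` elements. -/
theorem abel_binomial_bound_invariants (A B : ℂ[X]) (hA : A ≠ 0) (n : ℕ)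
    (hn : A.natDegree = n) (hodd : Odd n) :
    {p : ℂ[X] | p ≠ 0 ∧ p * derivative p - p * B + A = 0}.Finite ∧
    {p : ℂ[X] | p ≠ 0 ∧ p * derivative p - p * B + A = 0}.ncard ≤
      n.choose ((n + 1) / 2) + 1 := by
  subst hn
  have hfin : {p : ℂ[X] | p ≠ 0 ∧ p * derivative p - p * B + A = 0}.Finite := by
    by_contra hinf
    obtain ⟨F, hF, hcard⟩ := Set.Infinite.exists_subset_card_eq hinf
      (A.natDegree.choose ((A.natDegree + 1) / 2) + 2)
    have := AbelEquation.card_le_choose_add_one hA hodd fun p hp => hF hp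
    omega
  refine ⟨hfin, ?_⟩
  rw [Set.ncard_eq_toFinset_card _ hfin]
  exact AbelEquation.card_le_choose_add_one hA hodd fun p hp => hfin.mem_toFinset.1 hp
end

section
/- Let A, B ∈ ℂ[t] with A ≠ 0, let p₁, …, p_r ∈ ℂ[t] be nonzero invariant polynomials (pᵢpᵢ' − pᵢB + A = 0 for each i), let α₁, …, α_r ∈ ℂ, and set α₀ = −(α₁ + … + α_r). In ℂ[t,x], let K₀(t,x) = A(t)x² + B(t)x (the cofactor of the invariant curve x = 0) and Kᵢ(t,x) = A(t)x² + pᵢ'(t)x (the cofactor of 1 + pᵢ(t)x = 0). Then α₀K₀ + α₁K₁ + … + α_rK_r = 0 in ℂ[t,x] if and only if ∑_{i=1}^r αᵢ·(A/pᵢ) = 0 in ℂ[t], where A/pᵢ denotes the exact polynomial quotient. -/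
open Polynomial

/-- The exact quotient of `A` by an invariant polynomial `p` is `B - p'`. -/
theorem div_eq_sub_derivative_of_invariant {K : Type*} [Field K] {A B p : K[X]} (hp : p ≠ 0)
    (h : p * derivative p - p * B + A = 0) : A / p = B - derivative p := by
  have hA : A = p * (B - derivative p) := by linear_combination h
  rw [hA, mul_div_cancel_left₀ _ hp]

/-- with cofactors `K₀ = A x² + B x` (of `x = 0`) and
`Kᵢ = A x² + pᵢ' x` (of `1 + pᵢ(t)x = 0`), and `α₀ = -(α₁ + ⋯ + α_r)`, one has
`α₀ K₀ + ∑ αᵢ Kᵢ = 0` in `ℂ[t,x]` iff `∑ αᵢ (A / pᵢ) = 0` in `ℂ[t]`.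
Bivariate polynomials are encoded in `Polynomial ℂ[X]`, outer variable `x`. -/
theorem abel_cofactor_relation_iff (A B : ℂ[X]) (hA : A ≠ 0) (r : ℕ)
    (p : Fin r → ℂ[X]) (hp0 : ∀ i, p i ≠ 0)
    (hinv : ∀ i, p i * derivative (p i) - p i * B + A = 0)
    (α : Fin r → ℂ) :
    (Polynomial.C (Polynomial.C (-(∑ i, α i))) *
        (Polynomial.C A * Polynomial.X ^ 2 + Polynomial.C B * Polynomial.X) +
      ∑ i, Polynomial.C (Polynomial.C (α i)) *
        (Polynomial.C A * Polynomial.X ^ 2 +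
          Polynomial.C (derivative (p i)) * Polynomial.X) = 0) ↔
    ∑ i, Polynomial.C (α i) * (A / p i) = 0 := by
  have hcomb : Polynomial.C (Polynomial.C (-(∑ i, α i))) *
        (Polynomial.C A * Polynomial.X ^ 2 + Polynomial.C B * Polynomial.X) +
      ∑ i, Polynomial.C (Polynomial.C (α i)) *
        (Polynomial.C A * Polynomial.X ^ 2 +
          Polynomial.C (derivative (p i)) * Polynomial.X) =
      -(Polynomial.C (∑ i, Polynomial.C (α i) * (A / p i)) * Polynomial.X) := by
    simp only [map_neg, map_sum, Finset.sum_mul, ← Finset.sum_neg_distrib,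
      ← Finset.sum_add_distrib]
    refine Finset.sum_congr rfl fun i _ => ?_
    rw [div_eq_sub_derivative_of_invariant (hp0 i) (hinv i), map_mul, map_sub]
    ring
  rw [hcomb, neg_eq_zero, mul_eq_zero, or_iff_left X_ne_zero, C_eq_zero]
end

section
/- Let A, B ∈ ℂ[t] with A ≠ 0, let p₁, …, p_r ∈ ℂ[t] be nonzero invariant polynomials (pᵢpᵢ' − pᵢB + A = 0 for each i), and let α₁, …, α_r ∈ ℂ satisfy ∑_{i=1}^r αᵢ·(A/pᵢ) = 0 in ℂ[t] (exact polynomial quotients); set α₀ = −(α₁ + … + α_r). Let U ⊆ ℝ be an open interval and x : U → ℂ a differentiable solution of x'(t) = A(t)x(t)³ + B(t)x(t)² with x(t) ≠ 0 and 1 + pᵢ(t)x(t) ≠ 0 on U for every i. Then for all t ∈ U, α₀·(x'(t)/x(t)) + ∑_{i=1}^r αᵢ·(pᵢ'(t)x(t) + pᵢ(t)x'(t))/(1 + pᵢ(t)x(t)) = 0; that is, the logarithmic derivative along solutions of the Darboux function f(t,x) = x^{α₀}·∏_{i=1}^r (1 + pᵢ(t)x)^{αᵢ} vanishes, so f is a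 first integral of the Abel equation. -/
open Polynomial

/-- if `p₁, …, p_r` are nonzero invariant polynomials with
`∑ αᵢ (A/pᵢ) = 0` and `α₀ = -(α₁ + ⋯ + α_r)`, then along any solution `x` of the Abel
equation on the open interval `(a,b)` avoiding the zeros of `x` and of `1 + pᵢ x`, the
logarithmic derivative of the Darboux function `x^{α₀} ∏ (1 + pᵢ(t)x)^{αᵢ}` vanishes:
`α₀ x'/x + ∑ αᵢ (pᵢ' x + pᵢ x')/(1 + pᵢ x) = 0`, so it is a first integral. -/
theorem abel_darboux_log_derivative (A B : ℂ[X]) (hA : A ≠ 0) (r : ℕ)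
    (p : Fin r → ℂ[X]) (hp0 : ∀ i, p i ≠ 0)
    (hinv : ∀ i, p i * derivative (p i) - p i * B + A = 0)
    (α : Fin r → ℂ)
    (hα : ∑ i, Polynomial.C (α i) * (A / p i) = 0)
    (a b : ℝ) (x : ℝ → ℂ)
    (hx : ∀ t ∈ Set.Ioo a b, HasDerivAt x
      (Polynomial.eval (t : ℂ) A * x t ^ 3 + Polynomial.eval (t : ℂ) B * x t ^ 2) t)
    (hx0 : ∀ t ∈ Set.Ioo a b, x t ≠ 0)
    (hpx : ∀ i, ∀ t ∈ Set.Ioo a b, 1 + Polynomial.eval (t : ℂ) (p i) * x t ≠ 0) :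
    ∀ t ∈ Set.Ioo a b,
      (-(∑ i, α i)) * (deriv x t / x t) +
        ∑ i, α i *
          ((Polynomial.eval (t : ℂ) (derivative (p i)) * x t +
              Polynomial.eval (t : ℂ) (p i) * deriv x t) /
            (1 + Polynomial.eval (t : ℂ) (p i) * x t)) = 0 := by
  intro t ht
  rw [(hx t ht).deriv]
  have hfac : ∀ i, p i * (A / p i) = A := fun i =>
    EuclideanDomain.mul_div_cancel' (hp0 i) ⟨B - derivative (p i), by linear_combination hinv i⟩
  have hquot : ∀ i, derivative (p i) = B - A / p i := fun i =>
    mul_left_cancel₀ (hp0 i) (by linear_combination hinv i + hfac i)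
  have hsum : ∑ i, α i * (A / p i).eval (t : ℂ) = 0 := by
    simpa [eval_finsetSum] using congrArg (eval (t : ℂ)) hα
  have hterm : ∀ i, α i *
      (((derivative (p i)).eval (t : ℂ) * x t +
          (p i).eval (t : ℂ) * (A.eval (t : ℂ) * x t ^ 3 + B.eval (t : ℂ) * x t ^ 2)) /
        (1 + (p i).eval (t : ℂ) * x t)) =
      α i * ((A.eval (t : ℂ) * x t ^ 3 + B.eval (t : ℂ) * x t ^ 2) / x t) -
        α i * (A / p i).eval (t : ℂ) * x t := by
    intro i
    have hfac_eval : (p i).eval (t : ℂ) * (A / p i).eval (t : ℂ) = A.eval (t : ℂ) := by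
      rw [← eval_mul, hfac]
    have hpt := hpx i t ht
    have hxt := hx0 t ht
    rw [hquot i, eval_sub, mul_assoc, ← mul_sub]
    congr 1
    rw [div_eq_iff hpt]
    field_simp
    linear_combination x t * hfac_eval
  rw [Finset.sum_congr rfl fun i _ => hterm i, Finset.sum_sub_distrib, ← Finset.sum_mul,
    ← Finset.sum_mul, hsum]
  ring
end

section
/- Let A, B ∈ ℂ[t] with A ≠ 0 and deg(A) = 5. Then the set {p ∈ ℂ[t] : p ≠ 0 and p·p' − p·B + A = 0} of invariant polynomials has at most five elements; that is, the Abel equation x' = A(t)x³ + B(t)x² has at most five rational solutions of the form x(t) = −1/p(t). -/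
open Polynomial

/-- A multigraph on five vertices with five edges has no vertex weighting in which, for any two
distinct edges meeting at `r`, the weight of `r` plus the weights of both edges is a constant `T`
while the two edge weights differ. -/
theorem no_five_edges (x : Fin 5 → ℂ) (T : ℂ) (e : Fin 5 → Finset (Fin 5))
    (he : ∀ i, (e i).card = 2)
    (h : ∀ i j r, i ≠ j → r ∈ e i → r ∈ e j →
      x r + ∑ s ∈ e i, x s + ∑ s ∈ e j, x s = T ∧ ∑ s ∈ e i, x s ≠ ∑ s ∈ e j, x s) :
    False := by
  have hle : ∀ r ∈ Finset.univ, (Finset.univ.filter fun i => r ∈ e i).card ≤ 2 := by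
    intro r _
    by_contra! hlt
    obtain ⟨i, j, k, hi, hj, hk, hij, hik, hjk⟩ := Finset.two_lt_card_iff.1 hlt
    simp only [Finset.mem_filter, Finset.mem_univ, true_and] at hi hj hk
    refine (h j k r hjk hj hk).2 ?_
    linear_combination (h i j r hij hi hj).1 - (h i k r hik hi hk).1
  have hsum : ∑ r, (Finset.univ.filter fun i => r ∈ e i).card = ∑ _r : Fin 5, 2 := by
    simp_rw [Finset.card_filter]
    rw [Finset.sum_comm]
    simp [he]
  have hdeg := (Finset.sum_eq_sum_iff_of_le hle).1 hsum
  set y : Fin 5 → ℂ := fun r => x r - T / 5 with hy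
  have hτ : ∀ i, ∑ s ∈ e i, y s = ∑ s ∈ e i, x s - 2 * (T / 5) := by
    intro i
    simp [hy, Finset.sum_sub_distrib, he]
  have hharm : ∀ r, y r + ∑ i with r ∈ e i, ∑ s ∈ e i, y s = 0 := by
    intro r
    obtain ⟨i, j, hij, hEq⟩ := Finset.card_eq_two.1 (hdeg r (Finset.mem_univ r))
    have hi : r ∈ e i := by
      have : i ∈ Finset.univ.filter fun i => r ∈ e i := by simp [hEq]
      simpa using this
    have hj : r ∈ e j := by
      have : j ∈ Finset.univ.filter fun i => r ∈ e i := by simp [hEq]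
      simpa using this
    rw [hEq, Finset.sum_pair hij, hτ, hτ]
    linear_combination (h i j r hij hi hj).1
  have henergy : (∑ r, Complex.normSq (y r) + ∑ i, Complex.normSq (∑ s ∈ e i, y s) : ℝ) = 0 := by
    have hzero : ∑ r, star (y r) * (y r + ∑ i with r ∈ e i, ∑ s ∈ e i, y s) = 0 :=
      Finset.sum_eq_zero fun r _ => by rw [hharm, mul_zero]
    have hswap : ∑ r, star (y r) * ∑ i with r ∈ e i, ∑ s ∈ e i, y s =
        ∑ i, star (∑ s ∈ e i, y s) * ∑ s ∈ e i, y s := by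
      simp_rw [Finset.sum_filter, Finset.mul_sum (s := Finset.univ), star_sum, Finset.sum_mul]
      rw [Finset.sum_comm]
      refine Finset.sum_congr rfl fun i _ => ?_
      simp
    simp_rw [mul_add, Finset.sum_add_distrib] at hzero
    rw [hswap] at hzero
    have := congrArg Complex.re hzero
    simpa [Complex.normSq_eq_conj_mul_self, ← Complex.ofReal_inj] using hzero
  have hy0 : ∀ r, y r = 0 := by
    have h1 : ∑ r, Complex.normSq (y r) = 0 := by
      have h2 := Finset.sum_nonneg fun r (_ : r ∈ Finset.univ) => Complex.normSq_nonneg (y r)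
      have h3 := Finset.sum_nonneg fun i (_ : i ∈ Finset.univ) =>
        Complex.normSq_nonneg (∑ s ∈ e i, y s)
      linarith
    intro r
    rw [Finset.sum_eq_zero_iff_of_nonneg fun r _ => Complex.normSq_nonneg (y r)] at h1
    exact Complex.normSq_eq_zero.1 (h1 r (Finset.mem_univ r))
  have hconst : ∀ i, ∑ s ∈ e i, x s = 2 * (T / 5) := by
    intro i
    have := hτ i
    simp only [hy0, Finset.sum_const_zero] at this
    linear_combination -this
  obtain ⟨i, j, hij, hEq⟩ := Finset.card_eq_two.1 (hdeg 0 (Finset.mem_univ 0))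
  have hi : i ∈ Finset.univ.filter fun i => 0 ∈ e i := by simp [hEq]
  have hj : j ∈ Finset.univ.filter fun i => 0 ∈ e i := by simp [hEq]
  simp only [Finset.mem_filter, Finset.mem_univ, true_and] at hi hj
  exact (h i j 0 hij hi hj).2 (by rw [hconst, hconst])

theorem invariant_pair_identity {A B p q : ℂ[X]} (hp : p * derivative p - p * B + A = 0)
    (hq : q * derivative q - q * B + A = 0) :
    A * (p - q) = p * q * derivative (p - q) := by
  rw [derivative_sub]
  linear_combination p * hq - q * hp

theorem invariant_pair_degree {A B p q : ℂ[X]} (hA : A ≠ 0) (hpq : p ≠ q)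
    (hp : p * derivative p - p * B + A = 0) (hq : q * derivative q - q * B + A = 0) :
    (p - q).natDegree ≠ 0 ∧ p.natDegree + q.natDegree = A.natDegree + 1 ∧
      A.leadingCoeff = (p - q).natDegree * (p.leadingCoeff * q.leadingCoeff) := by
  have hid := invariant_pair_identity hp hq
  have hd : p - q ≠ 0 := sub_ne_zero.2 hpq
  have hne : p * q * derivative (p - q) ≠ 0 := hid ▸ mul_ne_zero hA hd
  have hd' : derivative (p - q) ≠ 0 := right_ne_zero_of_mul hne
  have hpq0 : p * q ≠ 0 := left_ne_zero_of_mul hne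
  have hp0 : p ≠ 0 := left_ne_zero_of_mul hpq0
  have hq0 : q ≠ 0 := right_ne_zero_of_mul hpq0
  have hm := derivative_ne_zero.1 hd'
  refine ⟨hm, ?_, ?_⟩
  · have := congrArg natDegree hid
    rw [natDegree_mul hA hd, natDegree_mul hpq0 hd', natDegree_mul hp0 hq0,
      natDegree_derivative] at this
    omega
  · have := congrArg leadingCoeff hid
    simp only [leadingCoeff_mul, leadingCoeff_derivative] at this
    refine mul_right_cancel₀ (leadingCoeff_ne_zero.2 hd) ?_
    linear_combination this

theorem exists_factorization_of_natDegree_eq {A : ℂ[X]} {n : ℕ} (h : A.natDegree = n) :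
    ∃ x : Fin n → ℂ, A = C A.leadingCoeff * ∏ i, (X - C (x i)) := by
  have hs := IsAlgClosed.splits A
  have hl : A.roots.toList.length = n := by
    rw [Multiset.length_toList, ← h, hs.natDegree_eq_card_roots]
  subst hl
  refine ⟨A.roots.toList.get, ?_⟩
  conv_lhs => rw [hs.eq_prod_roots, ← Multiset.coe_toList A.roots]
  rw [Multiset.map_coe, Multiset.prod_coe, ← List.prod_ofFn]
  congr 2
  exact (List.ofFn_getElem_eq_map _ _).symm

theorem exists_subset_of_mul_eq {ι : Type*} [Fintype ι] [DecidableEq ι] {a : ℂ} (ha : a ≠ 0)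
    {x : ι → ℂ} {p q : ℂ[X]} (h : p * q = C a * ∏ i, (X - C (x i))) :
    ∃ s : Finset ι, p = C p.leadingCoeff * ∏ i ∈ sᶜ, (X - C (x i)) ∧
      q = C (a / p.leadingCoeff) * ∏ i ∈ s, (X - C (x i)) := by
  obtain ⟨t, u, b, c, htu, hd, hbc, hp, hq⟩ :=
    mul_eq_mul_prime_prod (fun i _ => prime_X_sub_C (x i)) h
  have hb : IsUnit b := isUnit_of_mul_isUnit_left (hbc ▸ isUnit_C.2 ha.isUnit)
  have hc : IsUnit c := isUnit_of_mul_isUnit_right (hbc ▸ isUnit_C.2 ha.isUnit)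
  obtain ⟨b, hb', rfl⟩ := Polynomial.isUnit_iff.1 hb
  obtain ⟨c, -, rfl⟩ := Polynomial.isUnit_iff.1 hc
  have ht : t = uᶜ := by
    have hcod : Codisjoint u t := codisjoint_iff.2 (by rw [sup_comm]; exact htu)
    exact (IsCompl.mk hd.symm hcod).compl_eq.symm
  have hl : p.leadingCoeff = b := by
    rw [hp, leadingCoeff_mul, (monic_prod_X_sub_C x t).leadingCoeff, leadingCoeff_C, mul_one]
  have hbc' : a = b * c := C_injective (by rw [hbc, C_mul])
  refine ⟨u, by rw [hl, ← ht, hp], ?_⟩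
  rw [hl, hbc', mul_div_cancel_left₀ c hb'.ne_zero, hq]

theorem two_mul_common_root_eq {c κ r s t u v : ℂ} (hc : c ≠ 0) (hst : s ≠ t)
    (h : derivative (C c * ((X - C t) * ((X - C u) * (X - C v)))) +
        C κ * ((X - C r) * (X - C s)) =
      derivative (C c * ((X - C s) * ((X - C u) * (X - C v)))) +
        C κ * ((X - C r) * (X - C t))) :
    2 * r = u + v := by
  have := congrArg (eval r) h
  simp only [derivative_mul, derivative_C, derivative_sub, derivative_X, eval_add, eval_mul,
    eval_sub, eval_C, eval_X, eval_zero, eval_one, zero_mul] at this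
  refine mul_left_cancel₀ (mul_ne_zero hc (sub_ne_zero.2 hst)) ?_
  linear_combination this

theorem no_five_invariants_of_leadingCoeff_eq {A B : ℂ[X]} (hA : A ≠ 0) (h5 : A.natDegree = 5)
    {c : ℂ} (P : Fin 5 → ℂ[X]) (hinj : Function.Injective P)
    (hP : ∀ i, P i * derivative (P i) - P i * B + A = 0) (hdeg : ∀ i, (P i).natDegree = 3)
    (hlead : ∀ i, (P i).leadingCoeff = c) : False := by
  obtain ⟨x, hx⟩ := exists_factorization_of_natDegree_eq h5
  have hc : c ≠ 0 := by
    rw [← hlead 0, leadingCoeff_ne_zero]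
    rintro h0
    simpa [h0] using hdeg 0
  have hmul : ∀ i, P i * (B - derivative (P i)) = C A.leadingCoeff * ∏ i, (X - C (x i)) := by
    intro i
    rw [← hx]
    linear_combination -hP i
  choose e hp hq using fun i =>
    exists_subset_of_mul_eq (leadingCoeff_ne_zero.2 hA) (hmul i)
  simp only [hlead] at hp hq
  have he : ∀ i, (e i).card = 2 := by
    intro i
    have := hdeg i
    rw [hp i, natDegree_C_mul hc, natDegree_finsetProd_X_sub_C_eq_card,
      Finset.card_compl, Fintype.card_fin] at this
    omega
  refine no_five_edges x (∑ s, x s) e he fun i j r hij hi hj => ?_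
  have hpair : ∀ k, r ∈ e k → ∃ s, s ≠ r ∧ e k = {r, s} := by
    intro k hk
    obtain ⟨s, hs⟩ := Finset.card_eq_one.1
      (show ((e k).erase r).card = 1 by rw [Finset.card_erase_of_mem hk, he])
    refine ⟨s, Finset.ne_of_mem_erase (hs ▸ Finset.mem_singleton_self s), ?_⟩
    rw [← Finset.insert_erase hk, hs]
  obtain ⟨s, hsr, hes⟩ := hpair i hi
  obtain ⟨t, htr, het⟩ := hpair j hj
  have hst : s ≠ t := by
    rintro rfl
    exact hij (hinj (by rw [hp i, hp j, hes, het]))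
  obtain ⟨u, v, huv, hrest⟩ := Finset.card_eq_two.1
    (show (({r, s, t} : Finset (Fin 5))ᶜ).card = 2 by
      rw [Finset.card_compl, Finset.card_eq_three.2 ⟨r, s, t, hsr.symm, htr.symm, hst, rfl⟩]; rfl)
  have hmem : ∀ w, (w = u ∨ w = v) ↔ ¬ (w = r ∨ w = s ∨ w = t) := by
    intro w
    have := Finset.ext_iff.1 hrest w
    simpa using this.symm
  have hci : (e i)ᶜ = {t, u, v} := by
    ext w
    have := hmem w
    simp only [hes, Finset.mem_compl, Finset.mem_insert, Finset.mem_singleton]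
    grind
  have hcj : (e j)ᶜ = {s, u, v} := by
    ext w
    have := hmem w
    simp only [het, Finset.mem_compl, Finset.mem_insert, Finset.mem_singleton]
    grind
  have htn : t ∉ ({u, v} : Finset (Fin 5)) := by simp [hmem t]
  have hsn : s ∉ ({u, v} : Finset (Fin 5)) := by simp [hmem s]
  have hpi := hp i
  have hpj := hp j
  have hqi := hq i
  have hqj := hq j
  rw [hci, Finset.prod_insert htn, Finset.prod_pair huv] at hpi
  rw [hcj, Finset.prod_insert hsn, Finset.prod_pair huv] at hpj
  rw [hes, Finset.prod_pair hsr.symm] at hqi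
  rw [het, Finset.prod_pair htr.symm] at hqj
  have hxst : x s ≠ x t := fun h => hij (hinj (by rw [hpi, hpj, h]))
  have hruv : 2 * x r = x u + x v := by
    refine two_mul_common_root_eq (κ := A.leadingCoeff / c) hc hxst ?_
    rw [← hpi, ← hpj, ← hqi, ← hqj]
    ring
  have hsum : ∑ w, x w = x r + x s + x t + x u + x v := by
    rw [← Finset.sum_add_sum_compl {r, s, t}, hrest, Finset.sum_pair huv,
      Finset.sum_insert (by simp [hsr.symm, htr.symm]), Finset.sum_pair hst]
    ring
  rw [hes, het, Finset.sum_pair hsr.symm, Finset.sum_pair htr.symm, hsum]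
  exact ⟨by linear_combination hruv, fun h => hxst (add_left_cancel h)⟩

theorem invariant_leadingCoeff_of_ne {A B p q : ℂ[X]} (hA : A ≠ 0) (hp3 : p.natDegree = 3)
    (hq3 : q.natDegree = 3) (hp : p * derivative p - p * B + A = 0)
    (hq : q * derivative q - q * B + A = 0) (hne : p.leadingCoeff ≠ q.leadingCoeff) :
    A.leadingCoeff = 3 * (p.leadingCoeff * q.leadingCoeff) := by
  obtain ⟨-, -, h⟩ := invariant_pair_degree hA (ne_of_apply_ne _ hne) hp hq
  have hd : (p - q).natDegree = 3 := by
    refine natDegree_eq_of_le_of_coeff_ne_zero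
      ((natDegree_sub_le _ _).trans (by simp [hp3, hq3])) ?_
    simpa [leadingCoeff, hp3, hq3, sub_eq_zero] using hne
  simpa [hd] using h

theorem invariant_leadingCoeff_of_eq {A B p q : ℂ[X]} (hA : A ≠ 0) (hp3 : p.natDegree = 3)
    (hq3 : q.natDegree = 3) (hp : p * derivative p - p * B + A = 0)
    (hq : q * derivative q - q * B + A = 0) (hpq : p ≠ q)
    (heq : p.leadingCoeff = q.leadingCoeff) :
    A.leadingCoeff = p.leadingCoeff ^ 2 ∨ A.leadingCoeff = 2 * p.leadingCoeff ^ 2 := by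
  obtain ⟨hm, -, h⟩ := invariant_pair_degree hA hpq hp hq
  have hle : (p - q).natDegree ≤ 3 := (natDegree_sub_le _ _).trans (by simp [hp3, hq3])
  have hne : (p - q).natDegree ≠ 3 := by
    intro h3
    have h0 : (p - q).coeff 3 = 0 := by
      simpa [leadingCoeff, hp3, hq3, sub_eq_zero] using heq
    rw [← h3] at h0
    simp [leadingCoeff_eq_zero.1 h0] at h3
  have h12 : (p - q).natDegree = 1 ∨ (p - q).natDegree = 2 := by omega
  rcases h12 with h1 | h2
  · left
    rw [h, h1, ← heq]
    ring
  · right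
    rw [h, h2, ← heq]
    ring

theorem invariant_card_le_five {A B : ℂ[X]} (hA : A ≠ 0) (h5 : A.natDegree = 5)
    (F : Finset ℂ[X]) (hF : ∀ p ∈ F, p * derivative p - p * B + A = 0) : F.card ≠ 6 := by
  intro hcard
  have ha : A.leadingCoeff ≠ 0 := leadingCoeff_ne_zero.2 hA
  have h3 : ∀ p ∈ F, p.natDegree = 3 := by
    intro p hp
    obtain ⟨q, hq, r, hr, hqr⟩ := Finset.one_lt_card.1
      (show 1 < (F.erase p).card by rw [Finset.card_erase_of_mem hp, hcard]; norm_num)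
    obtain ⟨hqp, hq⟩ := Finset.mem_erase.1 hq
    obtain ⟨hrp, hr⟩ := Finset.mem_erase.1 hr
    have h1 := (invariant_pair_degree hA hqp (hF q hq) (hF p hp)).2.1
    have h2 := (invariant_pair_degree hA hrp (hF r hr) (hF p hp)).2.1
    have h3 := (invariant_pair_degree hA hqr (hF q hq) (hF r hr)).2.1
    omega
  have hdiff : ∀ p ∈ F, ∀ q ∈ F, p.leadingCoeff ≠ q.leadingCoeff →
      A.leadingCoeff = 3 * (p.leadingCoeff * q.leadingCoeff) := fun p hp q hq =>
    invariant_leadingCoeff_of_ne hA (h3 p hp) (h3 q hq) (hF p hp) (hF q hq)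
  have hsame : ∀ p ∈ F, ∀ q ∈ F, p ≠ q → p.leadingCoeff = q.leadingCoeff →
      A.leadingCoeff = p.leadingCoeff ^ 2 ∨ A.leadingCoeff = 2 * p.leadingCoeff ^ 2 :=
    fun p hp q hq => invariant_leadingCoeff_of_eq hA (h3 p hp) (h3 q hq) (hF p hp) (hF q hq)
  have htwo : ∀ p ∈ F, ∀ q ∈ F, ∀ r ∈ F, p.leadingCoeff ≠ q.leadingCoeff →
      p.leadingCoeff ≠ r.leadingCoeff → q.leadingCoeff = r.leadingCoeff := by
    intro p hp q hq r hr hpq hpr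
    have hp0 : p.leadingCoeff ≠ 0 := by
      intro h0
      exact ha (by simpa [h0] using hdiff p hp q hq hpq)
    refine mul_left_cancel₀ (mul_ne_zero three_ne_zero hp0) ?_
    linear_combination hdiff p hp r hr hpr - hdiff p hp q hq hpq
  obtain ⟨p, hp, q, hq, hpq, hlead⟩ :
      ∃ p ∈ F, ∃ q ∈ F, p ≠ q ∧ p.leadingCoeff = q.leadingCoeff := by
    obtain ⟨p, q, r, hp, hq, hr, hpq, hpr, hqr⟩ := Finset.two_lt_card_iff.1
      (show 2 < F.card by omega)
    by_cases h1 : p.leadingCoeff = q.leadingCoeff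
    · exact ⟨p, hp, q, hq, hpq, h1⟩
    by_cases h2 : p.leadingCoeff = r.leadingCoeff
    · exact ⟨p, hp, r, hr, hpr, h2⟩
    exact ⟨q, hq, r, hr, hqr, htwo p hp q hq r hr h1 h2⟩
  have hrest : (F.filter fun r => ¬ r.leadingCoeff = p.leadingCoeff).card ≤ 1 := by
    refine Finset.card_le_one.2 fun r hr s hs => ?_
    by_contra hrs
    obtain ⟨hr, hrp⟩ := Finset.mem_filter.1 hr
    obtain ⟨hs, hsp⟩ := Finset.mem_filter.1 hs
    have hl := htwo p hp r hr s hs (Ne.symm hrp) (Ne.symm hsp)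
    have h1 := hdiff p hp r hr (Ne.symm hrp)
    have h2 := hsame p hp q hq hpq hlead
    have h4 := hsame r hr s hs hrs hl
    have hsq : A.leadingCoeff ^ 2 = 9 * (p.leadingCoeff ^ 2 * r.leadingCoeff ^ 2) := by
      rw [h1]
      ring
    have ha2 : A.leadingCoeff ^ 2 ≠ 0 := pow_ne_zero 2 ha
    apply ha2
    rcases h2 with h2 | h2 <;> rcases h4 with h4 | h4 <;> grind
  have hfive : 5 ≤ (F.filter fun r => r.leadingCoeff = p.leadingCoeff).card := by
    have := Finset.card_filter_add_card_filter_not (s := F)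
      (fun r => r.leadingCoeff = p.leadingCoeff)
    omega
  obtain ⟨G, hG, hGcard⟩ := Finset.exists_subset_card_eq hfive
  let f := (G.equivFinOfCardEq hGcard).symm
  have hf : ∀ i, (f i : ℂ[X]) ∈ F ∧ (f i : ℂ[X]).leadingCoeff = p.leadingCoeff := fun i =>
    Finset.mem_filter.1 (hG (f i).2)
  exact no_five_invariants_of_leadingCoeff_eq hA h5 (fun i => (f i : ℂ[X]))
    (Subtype.val_injective.comp f.injective) (fun i => hF _ (hf i).1) (fun i => h3 _ (hf i).1)
    (fun i => (hf i).2)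

/-- if `deg A = 5` then the Abel equation `x' = A x³ + B x²` has at most five
nonzero invariant polynomials, i.e. at most five rational solutions `x(t) = -1/p(t)`. -/
theorem abel_deg5_at_most_five (A B : ℂ[X]) (hA : A ≠ 0) (h5 : A.natDegree = 5) :
    ∃ p₁ p₂ p₃ p₄ p₅ : ℂ[X],
      {p : ℂ[X] | p ≠ 0 ∧ p * derivative p - p * B + A = 0} ⊆
        {p₁, p₂, p₃, p₄, p₅} := by
  set S := {p : ℂ[X] | p ≠ 0 ∧ p * derivative p - p * B + A = 0}
  have hS : S.encard ≤ (5 : ℕ) := by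
    by_contra! hlt
    obtain ⟨T, hTS, hT⟩ := Set.exists_subset_encard_eq
      (show ((6 : ℕ) : ℕ∞) ≤ S.encard from Order.add_one_le_of_lt hlt)
    have hfin : T.Finite := Set.finite_of_encard_eq_coe hT
    refine invariant_card_le_five hA h5 hfin.toFinset
      (fun p hp => (hTS (hfin.mem_toFinset.1 hp)).2) ?_
    rw [hfin.encard_eq_coe_toFinset_card] at hT
    exact_mod_cast hT
  have hfin : S.Finite := Set.finite_of_encard_le_coe hS
  have hlen : hfin.toFinset.toList.length ≤ 5 := by
    rw [hfin.encard_eq_coe_toFinset_card] at hS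
    rw [Finset.length_toList]
    exact_mod_cast hS
  set l := hfin.toFinset.toList with hl
  refine ⟨l.getD 0 0, l.getD 1 0, l.getD 2 0, l.getD 3 0, l.getD 4 0, fun p hp => ?_⟩
  have hpl : p ∈ l := by simpa [hl] using hp
  obtain ⟨n, hn, rfl⟩ := List.getElem_of_mem hpl
  rw [← List.getD_eq_getElem l 0 hn]
  have : n < 5 := by omega
  interval_cases n <;> simp
end
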